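/- Let d ≥ 2 and let A, B be hermitian-closed unital subalgebras of M_d(ℂ). Then the Haar average over the full unitary group U(d) of the Mutual Averaged Non-commutativity of A with the conjugated algebra U B U† := {UXU† : X ∈ B} satisfies ∫_{U(d)} S(A : U B U†) dU = (1 − dim_ℂ(A')/d²)·(1 − dim_ℂ(B')/d²) / (1 − 1/d²). -/

import Mathlib

open MeasureTheory Matrix Kronecker

noncomputable section

instance matMeasurableSpace (n : Type*) [Fintype n] : MeasurableSpace (Matrix n n ℂ) :=
  show MeasurableSpace (n → n → ℂ) from inferInstance

/-- Squared Frobenius (Hilbert-Schmidt) norm `‖X‖₂² = Tr(X† X)`. -/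
def hs2 {n : Type*} [Fintype n] (X : Matrix n n ℂ) : ℝ := (Matrix.trace (Xᴴ * X)).re

/-- Mutual Averaged Non-commutativity: `(1/(2d)) ∫∫ ‖UV - VU‖₂² dμ(U) dν(V)`,
where `μ`, `ν` are meant to be the normalized Haar measures of the unitary groups of
the two algebras (imposed by the `IsHaar` hypotheses in the theorems below). -/
def MAN {n : Type*} [Fintype n] (μ ν : Measure (Matrix n n ℂ)) : ℝ :=
  (1 / (2 * (Fintype.card n : ℝ))) * ∫ U, ∫ V, hs2 (U * V - V * U) ∂ν ∂μ

/-- `μ` is the normalized Haar probability measure of the compact unitary group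
`U(A) = {U ∈ A : U†U = UU† = 1}` of the star-subalgebra `A`, viewed as a measure on
matrix space concentrated on `U(A)` and invariant under left translation by `U(A)`. -/
def IsHaar {n : Type*} [Fintype n] [DecidableEq n] (A : StarSubalgebra ℂ (Matrix n n ℂ))
    (μ : Measure (Matrix n n ℂ)) : Prop :=
  IsProbabilityMeasure μ ∧
  μ {U | ¬ (U ∈ A ∧ U ∈ unitary (Matrix n n ℂ))} = 0 ∧
  ∀ U ∈ A, U ∈ unitary (Matrix n n ℂ) → μ.map (fun V => U * V) = μ

/-- The commutant `A' = {X : XY = YX ∀ Y ∈ A}` as a ℂ-subspace of matrix space. -/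
def commSub {n : Type*} [Fintype n] [DecidableEq n] (A : StarSubalgebra ℂ (Matrix n n ℂ)) :
    Submodule ℂ (Matrix n n ℂ) where
  carrier := {X | ∀ Y ∈ A, X * Y = Y * X}
  add_mem' := by
    intro a b ha hb Y hY
    rw [add_mul, mul_add, ha Y hY, hb Y hY]
  zero_mem' := by
    intro Y hY
    rw [zero_mul, mul_zero]
  smul_mem' := by
    intro c X hX Y hY
    rw [smul_mul_assoc, hX Y hY, mul_smul_comm]

section Span

open scoped Matrix.Norms.L2Operator

variable {n : Type*} [Fintype n] [DecidableEq n]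

/-- A matrix commuting with all unitaries of a star-subalgebra lies in its commutant. -/
theorem mem_commSub_of_unitary (A : StarSubalgebra ℂ (Matrix n n ℂ)) (X : Matrix n n ℂ)
    (h : ∀ U ∈ A, U ∈ unitary (Matrix n n ℂ) → X * U = U * X) : X ∈ commSub A := by
  intro Y hY
  have hcl : IsClosed (A : Set (Matrix n n ℂ)) :=
    Submodule.closed_of_finiteDimensional (Subalgebra.toSubmodule A.toSubalgebra)
  have hmem : (⟨Y, hY⟩ : A) ∈ Submodule.span ℂ (unitary A : Set A) := by
    rw [CStarAlgebra.span_unitary A]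
    trivial
  have key : ∀ Z : A, Z ∈ Submodule.span ℂ (unitary A : Set A) →
      X * (Z : Matrix n n ℂ) = Z * X := by
    intro Z hZ
    induction hZ using Submodule.span_induction with
    | mem U hU =>
      refine h U U.2 ?_
      rw [Unitary.mem_iff]
      exact ⟨congrArg Subtype.val (Unitary.mem_iff.1 hU).1,
        congrArg Subtype.val (Unitary.mem_iff.1 hU).2⟩
    | zero => simp
    | add a b _ _ ha hb => simp [mul_add, add_mul, ha, hb]
    | smul c a _ ha => simp [ha]
  exact key _ hmem

end Span

section EquivariantMaps

variable {n : Type*} [Fintype n] [DecidableEq n]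

theorem sum_entries_eq_trace (f : Matrix n n ℂ →ₗ[ℂ] Matrix n n ℂ) :
    LinearMap.trace ℂ _ f = ∑ i, ∑ j, f (single i j 1) i j := by
  rw [LinearMap.trace_eq_matrix_trace ℂ (Matrix.stdBasis ℂ n n), Matrix.trace,
    Fintype.sum_prod_type]
  refine Finset.sum_congr rfl fun i _ => Finset.sum_congr rfl fun j _ => ?_
  rw [Matrix.diag_apply, LinearMap.toMatrix_apply, Matrix.stdBasis_eq_single]
  simp [Matrix.stdBasis]

/-- Equivariance under unitary conjugation implies equivariance under commutators
with hermitian projections. -/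
theorem map_commutator_of_isStarProjection (T : Matrix n n ℂ →ₗ[ℂ] Matrix n n ℂ)
    (hT : ∀ W ∈ unitary (Matrix n n ℂ), ∀ X, T (W * X * Wᴴ) = W * T X * Wᴴ)
    (P : Matrix n n ℂ) (hP : P * P = P) (hP' : Pᴴ = P) (X : Matrix n n ℂ) :
    T (P * X - X * P) = P * T X - T X * P := by
  have hu : ∀ z : ℂ, star z * z = 1 → (1 + (z - 1) • P) ∈ unitary (Matrix n n ℂ) := by
    intro z hz
    have hz' : (star z - 1) + (z - 1) + (star z - 1) * (z - 1) = 0 := by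
      linear_combination hz
    have hs : star (1 + (z - 1) • P) = 1 + (star z - 1) • P := by
      simp [star_eq_conjTranspose, hP']
    rw [Unitary.mem_iff, hs]
    constructor
    · have : (1 + (star z - 1) • P) * (1 + (z - 1) • P)
          = 1 + ((star z - 1) + (z - 1) + (star z - 1) * (z - 1)) • P := by
        simp only [mul_add, add_mul, mul_one, one_mul, smul_mul_smul_comm, hP]
        module
      rw [this, hz']; simp
    · have : (1 + (z - 1) • P) * (1 + (star z - 1) • P)
          = 1 + ((star z - 1) + (z - 1) + (star z - 1) * (z - 1)) • P := by
        simp only [mul_add, add_mul, mul_one, one_mul, smul_mul_smul_comm, hP]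
        module
      rw [this, hz']; simp
  have hdiff : ∀ Y : Matrix n n ℂ,
      (1 + (Complex.I - 1) • P) * Y * (1 + (Complex.I - 1) • P)ᴴ
        - (1 + (-Complex.I - 1) • P) * Y * (1 + (-Complex.I - 1) • P)ᴴ
      = (2 * Complex.I) • (P * Y - Y * P) := by
    intro Y
    simp only [conjTranspose_add, conjTranspose_one, conjTranspose_smul, hP', star_sub, star_neg,
      star_one, Complex.star_def, Complex.conj_I, mul_add, add_mul, mul_one, one_mul,
      smul_mul_assoc, mul_smul_comm, smul_add, smul_smul]
    have : (-Complex.I - 1) * (Complex.I - 1) = 2 := by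
      linear_combination -Complex.I_mul_I
    have h2 : (- -Complex.I - 1) * (-Complex.I - 1) = 2 := by
      linear_combination -Complex.I_mul_I
    rw [this, h2]
    module
  have h1 := hT _ (hu Complex.I (by simp)) X
  have h2 := hT _ (hu (-Complex.I) (by simp)) X
  have h3 := congrArg T (hdiff X)
  rw [map_sub, h1, h2, hdiff (T X), map_smul] at h3
  exact (smul_right_injective _ (by simp : (2 * Complex.I) ≠ 0) h3).symm

theorem map_commutator_single (T : Matrix n n ℂ →ₗ[ℂ] Matrix n n ℂ)
    (hT : ∀ W ∈ unitary (Matrix n n ℂ), ∀ X, T (W * X * Wᴴ) = W * T X * Wᴴ)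
    (i j : n) (X : Matrix n n ℂ) :
    T (single i j 1 * X - X * single i j 1) = single i j 1 * T X - T X * single i j 1 := by
  have hdiag : ∀ k : n, T (single k k 1 * X - X * single k k 1)
      = single k k 1 * T X - T X * single k k 1 := fun k =>
    map_commutator_of_isStarProjection T hT _ (by simp) (by simp) X
  rcases eq_or_ne i j with rfl | hij
  · exact hdiag i
  let Q : ℂ → Matrix n n ℂ := fun w => (1 / 2 : ℂ) • (single i i 1 + single j j 1
    + w • single i j 1 + star w • single j i 1)
  have hQ : ∀ w : ℂ, star w * w = 1 → T (Q w * X - X * Q w) = Q w * T X - T X * Q w := by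
    intro w hw
    refine map_commutator_of_isStarProjection T hT _ ?_ ?_ X
    · simp only [Q, mul_add, add_mul, smul_mul_assoc, mul_smul_comm,
        single_mul_single_same, single_mul_single_of_ne _ _ _ _ hij,
        single_mul_single_of_ne _ _ _ _ hij.symm, mul_one, smul_zero]
      match_scalars <;> first | ring1 | linear_combination (1 / 4) * hw
    · simp only [Q, conjTranspose_smul, conjTranspose_add, conjTranspose_single, star_star,
        star_one]
      norm_num
      module
  have hdec : single i j 1 = Q 1 - Complex.I • Q Complex.I
      - ((1 - Complex.I) / 2) • (single i i 1 + single j j 1) := by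
    simp only [Q, Complex.star_def, Complex.conj_I, map_one, smul_smul, smul_add]
    have h1 : Complex.I * (1 / 2 * Complex.I) = - (1 / 2) := by
      linear_combination (1 / 2) * Complex.I_mul_I
    have h2 : Complex.I * (1 / 2 * -Complex.I) = (1 / 2) := by
      linear_combination - (1 / 2) * Complex.I_mul_I
    rw [h1, h2]
    module
  have h1 := hQ 1 (by simp)
  have h2 := hQ Complex.I (by simp)
  have h3 := hdiag i
  have h4 := hdiag j
  have hlin : ∀ (Y R S C D : Matrix n n ℂ) (a b : ℂ),
      (R - a • S - b • (C + D)) * Y - Y * (R - a • S - b • (C + D))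
      = (R * Y - Y * R) - a • (S * Y - Y * S)
        - b • ((C * Y - Y * C) + (D * Y - Y * D)) := by
    intro Y R S C D a b
    simp only [sub_mul, mul_sub, add_mul, mul_add, smul_mul_assoc, mul_smul_comm]
    module
  rw [hdec, hlin, hlin, map_sub, map_sub, map_smul, map_smul, map_add, h1, h2, h3, h4]

/-- A linear map equivariant under commutators that kills one rank-one projection vanishes. -/
theorem eq_zero_of_map_commutator (T : Matrix n n ℂ →ₗ[ℂ] Matrix n n ℂ)
    (hT : ∀ i j X, T (single i j 1 * X - X * single i j 1)
      = single i j 1 * T X - T X * single i j 1)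
    (o : n) (ho : T (single o o 1) = 0) : T = 0 := by
  have hrow : ∀ j, T (single o j 1) = 0 := by
    intro j
    rcases eq_or_ne j o with rfl | hj
    · exact ho
    have := hT o j (single o o 1)
    rw [ho, single_mul_single_of_ne _ _ _ _ hj, single_mul_single_same] at this
    simpa using this
  have hall : ∀ i j, T (single i j 1) = 0 := by
    intro i j
    have h := hT i o (single o j 1)
    rw [hrow, single_mul_single_same] at h
    rcases eq_or_ne j i with rfl | hji
    · rw [single_mul_single_same] at h
      simpa [ho] using h
    · rw [single_mul_single_of_ne _ _ _ _ hji] at h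
      simpa using h
  refine LinearMap.ext fun X => ?_
  have hX : ∀ i j, T (single i j (X i j)) = 0 := by
    intro i j
    have : single i j (X i j) = X i j • single i j (1 : ℂ) := by simp
    rw [this, map_smul, hall, smul_zero]
  rw [matrix_eq_sum_single X, map_sum]
  simp [map_sum, hX]

/-- Linear maps equivariant under unitary conjugation are combinations of the identity
and the trace. -/
theorem exists_eq_smul_add_trace (T : Matrix n n ℂ →ₗ[ℂ] Matrix n n ℂ)
    (hT : ∀ W ∈ unitary (Matrix n n ℂ), ∀ X, T (W * X * Wᴴ) = W * T X * Wᴴ)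
    [Nontrivial n] :
    ∃ a b : ℂ, ∀ X, T X = a • X + (b * trace X) • (1 : Matrix n n ℂ) := by
  have hc := map_commutator_single T hT
  obtain ⟨o, p, hop⟩ := exists_pair_ne n
  set Y := T (single o o 1) with hY
  have hcomm : ∀ i j, i ≠ o → j ≠ o → Commute (single i j 1) Y := by
    intro i j hi hj
    have := hc i j (single o o 1)
    rw [single_mul_single_of_ne _ _ _ _ hj, single_mul_single_of_ne _ _ _ _ hi.symm] at this
    simp only [sub_self, map_zero] at this
    exact (sub_eq_zero.1 this.symm)
  have hcommo : Commute (single o o 1) Y := by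
    have := hc o o (single o o 1)
    simp only [sub_self, map_zero] at this
    exact (sub_eq_zero.1 this.symm)
  have hoff : ∀ i j, i ≠ j → Y i j = 0 := by
    intro i j hij
    rcases eq_or_ne j o with rfl | hj
    · exact col_eq_zero_of_commute_single hcommo hij
    · exact col_eq_zero_of_commute_single (hcomm j j hj hj) hij
  have hYeq : Y = (Y o o - Y p p) • single o o 1 + Y p p • (1 : Matrix n n ℂ) := by
    ext i j
    rcases eq_or_ne i j with rfl | hij
    · rcases eq_or_ne i o with rfl | hi
      · simp
      · have := diag_eq_of_commute_single (hcomm i p hi hop.symm)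
        simp [hi.symm, this]
    · rw [hoff i j hij]
      have : ¬ (o = i ∧ o = j) := fun h => hij (h.1 ▸ h.2)
      simp [this, hij]
  set a := Y o o - Y p p
  set b := Y p p
  let T' : Matrix n n ℂ →ₗ[ℂ] Matrix n n ℂ := T - a • LinearMap.id
    - b • (Matrix.traceLinearMap n ℂ ℂ).smulRight (1 : Matrix n n ℂ)
  have hT'a : ∀ X, T' X = T X - a • X - (b * trace X) • (1 : Matrix n n ℂ) := by
    intro X; simp [T', smul_smul]
  have h0 : T' = 0 := by
    refine eq_zero_of_map_commutator T' (fun i j X => ?_) o ?_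
    · rw [hT'a, hT'a, hc, trace_sub, trace_mul_comm]
      simp only [sub_mul, mul_sub, smul_mul_assoc, mul_smul_comm, mul_one, one_mul, sub_self,
        mul_zero, zero_smul]
      module
    · rw [hT'a, ← hY, hYeq]
      simp
  refine ⟨a, b, fun X => ?_⟩
  have := hT'a X
  rw [h0, LinearMap.zero_apply] at this
  rw [sub_sub] at this
  exact sub_eq_zero.1 this.symm

end EquivariantMaps
section Twirl

open scoped Matrix.Norms.L2Operator

variable {n : Type*} [Fintype n] [DecidableEq n]

instance matBorelSpace : BorelSpace (Matrix n n ℂ) :=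
  inferInstanceAs (BorelSpace (n → n → ℂ))

instance matSecondCountableTopology : SecondCountableTopology (Matrix n n ℂ) :=
  inferInstanceAs (SecondCountableTopology (n → n → ℂ))

variable (ρ : Measure (Matrix n n ℂ)) [IsProbabilityMeasure ρ] (W : Matrix n n ℂ → Matrix n n ℂ)

theorem integrable_conj_unitary (hW : Continuous W) (hu : ∀ᵐ U ∂ρ, W U ∈ unitary (Matrix n n ℂ))
    (X : Matrix n n ℂ) : Integrable (fun U => W U * X * (W U)ᴴ) ρ := by
  refine Integrable.of_bound (C := ‖X‖) (by fun_prop) ?_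
  filter_upwards [hu] with U hU
  rw [← star_eq_conjTranspose, CStarRing.norm_mul_mem_unitary _ (Unitary.star_mem hU),
    CStarRing.norm_mem_unitary_mul _ hU]

/-- The average of the conjugations `X ↦ W X W†`. -/
def twirl (hW : Continuous W) (hu : ∀ᵐ U ∂ρ, W U ∈ unitary (Matrix n n ℂ)) :
    Matrix n n ℂ →ₗ[ℂ] Matrix n n ℂ where
  toFun X := ∫ U, W U * X * (W U)ᴴ ∂ρ
  map_add' X Y := by
    simp only [mul_add, add_mul]
    exact integral_add (integrable_conj_unitary ρ W hW hu X) (integrable_conj_unitary ρ W hW hu Y)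
  map_smul' c X := by
    simp only [mul_smul_comm, smul_mul_assoc, RingHom.id_apply]
    exact integral_smul c _

variable {ρ W} (hW : Continuous W) (hu : ∀ᵐ U ∂ρ, W U ∈ unitary (Matrix n n ℂ))

theorem twirl_apply (X : Matrix n n ℂ) : twirl ρ W hW hu X = ∫ U, W U * X * (W U)ᴴ ∂ρ := rfl

theorem map_twirl {F : Type*} [NormedAddCommGroup F] [NormedSpace ℂ F] [CompleteSpace F]
    (L : Matrix n n ℂ →ₗ[ℂ] F) (X : Matrix n n ℂ) :
    L (twirl ρ W hW hu X) = ∫ U, L (W U * X * (W U)ᴴ) ∂ρ :=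
  (ContinuousLinearMap.integral_comp_comm (LinearMap.toContinuousLinearMap L)
    (integrable_conj_unitary ρ W hW hu X)).symm

theorem conj_twirl (Z X : Matrix n n ℂ) : Z * twirl ρ W hW hu X * Zᴴ
    = ∫ U, Z * (W U * X * (W U)ᴴ) * Zᴴ ∂ρ :=
  map_twirl hW hu ((LinearMap.mulRight ℂ Zᴴ).comp (LinearMap.mulLeft ℂ Z)) X

theorem trace_twirl : LinearMap.trace ℂ _ (twirl ρ W hW hu)
    = ((∫ U, Complex.normSq (trace (W U)) ∂ρ : ℝ) : ℂ) := by
  have hentry : ∀ i j, twirl ρ W hW hu (single i j 1) i j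
      = ∫ U, (W U * single i j (1 : ℂ) * (W U)ᴴ : Matrix n n ℂ) i j ∂ρ := fun i j =>
    map_twirl hW hu (Matrix.entryLinearMap ℂ ℂ i j) _
  have hint : ∀ i j, Integrable
      (fun U => (W U * single i j (1 : ℂ) * (W U)ᴴ : Matrix n n ℂ) i j) ρ := fun i j =>
    (LinearMap.toContinuousLinearMap (Matrix.entryLinearMap ℂ ℂ i j)).integrable_comp
      (integrable_conj_unitary ρ W hW hu (single i j 1))
  rw [sum_entries_eq_trace, ← integral_complex_ofReal]
  simp only [hentry]
  rw [Finset.sum_congr rfl fun i _ => (integral_finsetSum _ fun j _ => hint i j).symm,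
    ← integral_finsetSum _ fun i _ => integrable_finsetSum _ fun j _ => hint i j]
  congr 1
  ext U
  rw [← Complex.mul_conj, trace, map_sum, Finset.sum_mul_sum]
  refine Finset.sum_congr rfl fun i _ => Finset.sum_congr rfl fun j _ => ?_
  rw [mul_apply, Finset.sum_eq_single j]
  · simp
  · intro b _ hb
    simp [mul_single_apply_of_ne _ _ _ _ _ hb]
  · simp

end Twirl

section Haar

open scoped Matrix.Norms.L2Operator

variable {n : Type*} [Fintype n] [DecidableEq n]

theorem IsHaar.ae_mem {A : StarSubalgebra ℂ (Matrix n n ℂ)} {μ : Measure (Matrix n n ℂ)}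
    (h : IsHaar A μ) : ∀ᵐ U ∂μ, U ∈ A ∧ U ∈ unitary (Matrix n n ℂ) := h.2.1

theorem IsHaar.integral_mul_left {A : StarSubalgebra ℂ (Matrix n n ℂ)}
    {μ : Measure (Matrix n n ℂ)} (h : IsHaar A μ) {F : Type*} [NormedAddCommGroup F]
    [NormedSpace ℝ F] [SecondCountableTopology F] {f : Matrix n n ℂ → F} (hf : Continuous f)
    {U : Matrix n n ℂ} (hU : U ∈ A) (hU' : U ∈ unitary (Matrix n n ℂ)) :
    ∫ V, f (U * V) ∂μ = ∫ V, f V ∂μ := by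
  conv_rhs => rw [← h.2.2 U hU hU']
  rw [integral_map (by fun_prop) (by fun_prop)]

/-- The average of `|Tr U|²` over the unitary group of `A` is the dimension of the commutant. -/
theorem IsHaar.integral_normSq_trace {A : StarSubalgebra ℂ (Matrix n n ℂ)}
    {μ : Measure (Matrix n n ℂ)} (h : IsHaar A μ) :
    ∫ U, Complex.normSq (trace U) ∂μ = Module.finrank ℂ (commSub A) := by
  have := h.1
  have hu : ∀ᵐ U ∂μ, id U ∈ unitary (Matrix n n ℂ) := h.ae_mem.mono fun _ hU => hU.2
  have hproj : LinearMap.IsProj (commSub A) (twirl μ id continuous_id hu) := by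
    constructor
    · intro X
      refine mem_commSub_of_unitary A _ fun U hU hU' => ?_
      have h1 : U * twirl μ id continuous_id hu X * Uᴴ = twirl μ id continuous_id hu X := by
        rw [conj_twirl, twirl_apply, ← h.integral_mul_left (f := fun V => id V * X * (id V)ᴴ)
          (by fun_prop) hU hU']
        simp only [id, conjTranspose_mul, mul_assoc]
      have h2 : Uᴴ * U = 1 := hU'.1
      calc _ = (U * twirl μ id continuous_id hu X * Uᴴ) * U := by rw [h1]
        _ = _ := by rw [mul_assoc, h2, mul_one]
    · intro X hX
      rw [twirl_apply]
      have : (fun U => id U * X * (id U)ᴴ) =ᵐ[μ] fun _ => X := by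
        filter_upwards [h.ae_mem] with U hU
        have h2 : U * Uᴴ = 1 := hU.2.2
        rw [id, ← hX U hU.1, mul_assoc, h2, mul_one]
      rw [integral_congr_ae this]
      simp
  have h1 := hproj.trace
  rw [trace_twirl] at h1
  exact_mod_cast h1

theorem trace_smul_id_add_trace (T : Matrix n n ℂ →ₗ[ℂ] Matrix n n ℂ) (a b : ℂ)
    (h : ∀ X, T X = a • X + (b * trace X) • (1 : Matrix n n ℂ)) :
    LinearMap.trace ℂ _ T = a * (Fintype.card n : ℂ) ^ 2 + b * (Fintype.card n : ℂ) := by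
  have hT : T = a • LinearMap.id + b • (Matrix.traceLinearMap n ℂ ℂ).smulRight 1 := by
    ext1 X
    simp [h, smul_smul]
  rw [hT]
  rw [map_add, map_smul, map_smul, LinearMap.trace_id, LinearMap.trace_smulRight]
  simp [Module.finrank_matrix]
  left
  ring

end Haar

section Commutator

open scoped Matrix.Norms.L2Operator

variable {n : Type*} [Fintype n]

open scoped ComplexOrder in
theorem hs2_nonneg (X : Matrix n n ℂ) : 0 ≤ hs2 X :=
  (Complex.le_def.1 (posSemidef_conjTranspose_mul_self X).trace_nonneg).1

theorem continuous_hs2 : Continuous (hs2 : Matrix n n ℂ → ℝ) := by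
  unfold hs2
  fun_prop

variable [DecidableEq n]

theorem hs2_commutator {X W : Matrix n n ℂ} (hX : X ∈ unitary (Matrix n n ℂ))
    (hW : W ∈ unitary (Matrix n n ℂ)) :
    hs2 (X * W - W * X) = 2 * (Fintype.card n : ℝ) - 2 * (trace (Wᴴ * X * W * Xᴴ)).re := by
  have hX1 : Xᴴ * X = 1 := hX.1
  have hW1 : Wᴴ * W = 1 := hW.1
  have h1 : Wᴴ * Xᴴ * (X * W) = 1 := by
    rw [mul_assoc, ← mul_assoc Xᴴ, hX1, one_mul, hW1]
  have h2 : Xᴴ * Wᴴ * (W * X) = 1 := by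
    rw [mul_assoc, ← mul_assoc Wᴴ, hW1, one_mul, hX1]
  have h3 : trace (Xᴴ * Wᴴ * (X * W)) = trace (Wᴴ * X * W * Xᴴ) := by
    rw [trace_mul_comm (Wᴴ * X * W)]
    simp only [mul_assoc]
  have h4 : trace (Wᴴ * Xᴴ * (W * X)) = star (trace (Wᴴ * X * W * Xᴴ)) := by
    rw [← h3, ← trace_conjTranspose]
    simp [mul_assoc]
  rw [hs2, conjTranspose_sub, conjTranspose_mul, conjTranspose_mul, sub_mul, mul_sub, mul_sub,
    h1, h2, trace_sub, trace_sub, trace_sub, h3, h4, trace_one]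
  simp
  ring

theorem conj_mem_unitary {U V : Matrix n n ℂ} (hU : U ∈ unitary (Matrix n n ℂ))
    (hV : V ∈ unitary (Matrix n n ℂ)) : U * V * Uᴴ ∈ unitary (Matrix n n ℂ) :=
  mul_mem (mul_mem hU hV) (Unitary.star_mem hU)

theorem norm_trace_le_card {U : Matrix n n ℂ} (hU : U ∈ unitary (Matrix n n ℂ)) :
    ‖trace U‖ ≤ Fintype.card n := by
  refine (norm_sum_le _ _).trans ?_
  refine (Finset.sum_le_card_nsmul _ _ 1 fun i _ => entry_norm_bound_of_unitary hU i i).trans ?_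
  simp

theorem hs2_commutator_le {X W : Matrix n n ℂ} (hX : X ∈ unitary (Matrix n n ℂ))
    (hW : W ∈ unitary (Matrix n n ℂ)) :
    hs2 (X * W - W * X) ≤ 4 * (Fintype.card n : ℝ) := by
  have hu : Wᴴ * X * W * Xᴴ ∈ unitary (Matrix n n ℂ) :=
    mul_mem (mul_mem (mul_mem (Unitary.star_mem hW) hX) hW) (Unitary.star_mem hX)
  have h1 : ‖trace (Wᴴ * X * W * Xᴴ)‖ ≤ Fintype.card n := norm_trace_le_card hu
  have h2 := (abs_le.1 ((Complex.abs_re_le_norm _).trans h1)).1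
  rw [hs2_commutator hX hW]
  linarith

theorem IsHaar.twirl_conj_equivariant {κ : Measure (Matrix n n ℂ)} [IsProbabilityMeasure κ]
    (hκ : IsHaar (⊤ : StarSubalgebra ℂ (Matrix n n ℂ)) κ) {V : Matrix n n ℂ}
    (hcont : Continuous fun U : Matrix n n ℂ => U * V * Uᴴ)
    (hu : ∀ᵐ U ∂κ, U * V * Uᴴ ∈ unitary (Matrix n n ℂ)) :
    ∀ Z ∈ unitary (Matrix n n ℂ), ∀ Y,
      twirl κ _ hcont hu (Z * Y * Zᴴ) = Z * twirl κ _ hcont hu Y * Zᴴ := by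
  intro Z hZ Y
  have hZ1 : Zᴴ * Z = 1 := hZ.1
  have hf : Continuous fun U => U * V * Uᴴ * (Z * Y * Zᴴ) * (U * V * Uᴴ)ᴴ :=
    (hcont.matrix_mul continuous_const).matrix_mul hcont.matrix_conjTranspose
  rw [conj_twirl, twirl_apply]
  refine (hκ.integral_mul_left hf trivial hZ).symm.trans ?_
  have hZ2 : ∀ M : Matrix n n ℂ, Zᴴ * (Z * M) = M := fun M => by
    rw [← mul_assoc, hZ1, one_mul]
  simp only [conjTranspose_mul, conjTranspose_conjTranspose, mul_assoc, hZ2]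

/-- The Haar average of `‖[X, U V U†]‖₂²` over the full unitary group. -/
theorem integral_hs2_commutator_conj [Nontrivial n] {κ : Measure (Matrix n n ℂ)}
    (hκ : IsHaar (⊤ : StarSubalgebra ℂ (Matrix n n ℂ)) κ) {X V : Matrix n n ℂ}
    (hX : X ∈ unitary (Matrix n n ℂ)) (hV : V ∈ unitary (Matrix n n ℂ)) :
    ∫ U, hs2 (X * (U * V * Uᴴ) - (U * V * Uᴴ) * X) ∂κ
      = 2 * (Fintype.card n : ℝ) * ((1 - Complex.normSq (trace X) / (Fintype.card n : ℝ) ^ 2) *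
        ((1 - Complex.normSq (trace V) / (Fintype.card n : ℝ) ^ 2) /
          (1 - 1 / (Fintype.card n : ℝ) ^ 2))) := by
  have := hκ.1
  have hcont : Continuous fun U : Matrix n n ℂ => U * Vᴴ * Uᴴ := by fun_prop
  have hu : ∀ᵐ U ∂κ, U * Vᴴ * Uᴴ ∈ unitary (Matrix n n ℂ) :=
    hκ.ae_mem.mono fun U hU => conj_mem_unitary hU.2 (Unitary.star_mem hV)
  set T := twirl κ _ hcont hu with hTdef
  obtain ⟨a, b, hab⟩ := exists_eq_smul_add_trace T (hκ.twirl_conj_equivariant hcont hu)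
  have htr := trace_smul_id_add_trace T a b hab
  have hnorm : ∫ U, Complex.normSq (trace (U * Vᴴ * Uᴴ)) ∂κ = Complex.normSq (trace V) := by
    have : (fun U => Complex.normSq (trace (U * Vᴴ * Uᴴ))) =ᵐ[κ]
        fun _ => Complex.normSq (trace V) := by
      filter_upwards [hκ.ae_mem] with U hU
      have hU1 : Uᴴ * U = 1 := hU.2.1
      rw [trace_mul_comm, ← mul_assoc, hU1, one_mul, trace_conjTranspose]
      exact Complex.normSq_conj _
    rw [integral_congr_ae this]
    simp
  rw [hTdef, trace_twirl, hnorm] at htr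
  have hone : T 1 = 1 := by
    rw [hTdef, twirl_apply]
    have : (fun U => U * Vᴴ * Uᴴ * 1 * (U * Vᴴ * Uᴴ)ᴴ) =ᵐ[κ] fun _ => (1 : Matrix n n ℂ) := by
      filter_upwards [hu] with U hU
      rw [mul_one]
      exact hU.2
    rw [integral_congr_ae this]
    simp
  have hsum : a + b * Fintype.card n = 1 := by
    obtain ⟨o⟩ := (inferInstance : Nonempty n)
    have := congrFun (congrFun ((hab 1).symm.trans hone) o) o
    simpa using this
  have hTX : trace (T X * Xᴴ) = a * Fintype.card n + b * Complex.normSq (trace X) := by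
    have hX2 : X * Xᴴ = 1 := hX.2
    rw [hab, add_mul, smul_mul_assoc, smul_mul_assoc, one_mul, hX2, trace_add, trace_smul,
      trace_smul, trace_one, trace_conjTranspose, ← Complex.mul_conj]
    simp only [smul_eq_mul, Complex.star_def]
    ring
  have hmap := map_twirl hcont hu ((Matrix.traceLinearMap n ℂ ℂ).comp (LinearMap.mulRight ℂ Xᴴ)) X
  have hint : Integrable
      (fun U => trace (U * Vᴴ * Uᴴ * X * (U * Vᴴ * Uᴴ)ᴴ * Xᴴ)) κ :=
    (LinearMap.toContinuousLinearMap ((Matrix.traceLinearMap n ℂ ℂ).comp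
      (LinearMap.mulRight ℂ Xᴴ))).integrable_comp (integrable_conj_unitary κ _ hcont hu X)
  simp only [LinearMap.comp_apply, LinearMap.mulRight_apply, traceLinearMap_apply] at hmap
  rw [← hTdef, hTX] at hmap
  have hae : (fun U => hs2 (X * (U * V * Uᴴ) - (U * V * Uᴴ) * X)) =ᵐ[κ]
      fun U => 2 * (Fintype.card n : ℝ)
        - 2 * RCLike.re (trace (U * Vᴴ * Uᴴ * X * (U * Vᴴ * Uᴴ)ᴴ * Xᴴ)) := by
    filter_upwards [hκ.ae_mem] with U hU
    rw [hs2_commutator hX (conj_mem_unitary hU.2 hV)]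
    simp [mul_assoc]
  rw [integral_congr_ae hae, integral_sub (integrable_const _) (hint.re.const_mul 2),
    integral_const_mul, integral_const_mul, integral_re hint, ← hmap]
  have hd : (1 : ℝ) < Fintype.card n := by exact_mod_cast Fintype.one_lt_card
  generalize (Fintype.card n : ℕ) = d at *
  have hd1 : ((d : ℝ) ^ 2 - 1) ≠ 0 := by nlinarith
  have hd0 : (d : ℝ) ≠ 0 := by positivity
  have hd1' : ((d : ℂ) ^ 2 - 1) ≠ 0 := by exact_mod_cast hd1
  have hd0' : (d : ℂ) ≠ 0 := by exact_mod_cast hd0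
  have ha : a = (((Complex.normSq (trace V) - 1) / ((d : ℝ) ^ 2 - 1) : ℝ) : ℂ) := by
    push_cast
    rw [eq_div_iff hd1']
    linear_combination -htr - hsum
  have hb : b = (((1 - (Complex.normSq (trace V) - 1) / ((d : ℝ) ^ 2 - 1)) / d : ℝ) : ℂ) := by
    rw [Complex.ofReal_div, Complex.ofReal_sub, ← ha]
    push_cast
    rw [eq_div_iff hd0']
    linear_combination hsum
  have hre : RCLike.re (a * d + b * Complex.normSq (trace X))
      = (Complex.normSq (trace V) - 1) / ((d : ℝ) ^ 2 - 1) * d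
        + (1 - (Complex.normSq (trace V) - 1) / ((d : ℝ) ^ 2 - 1)) / d
          * Complex.normSq (trace X) := by
    rw [ha, hb]
    norm_cast
  rw [hre]
  simp only [integral_const, probReal_univ, smul_eq_mul, one_mul]
  have hd2 : (1 - 1 / (d : ℝ) ^ 2) = ((d : ℝ) ^ 2 - 1) / d ^ 2 := by field_simp
  rw [hd2]
  field_simp
  ring

end Commutator

/-- Haar average over the full unitary group of `S(A : U B U†)`:
`∫ S(A : UBU†) dU = (1 - dim A'/d²)(1 - dim B'/d²)/(1 - 1/d²)`.
The Haar measure of the unitary group of `U B U†` is the pushforward of that of `B`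
under conjugation by `U`, so `S(A : UBU†) = (1/(2d)) ∫∫ ‖[X, UVU†]‖₂² dμ(X) dν(V)`. -/
theorem stmt_8 (d : ℕ) (hd : 2 ≤ d)
    (A B : StarSubalgebra ℂ (Matrix (Fin d) (Fin d) ℂ))
    (μ ν κ : Measure (Matrix (Fin d) (Fin d) ℂ))
    (hμ : IsHaar A μ) (hν : IsHaar B ν)
    (hκ : IsHaar (⊤ : StarSubalgebra ℂ (Matrix (Fin d) (Fin d) ℂ)) κ) :
    (∫ U, ((1 / (2 * (d : ℝ))) *
        ∫ X, ∫ V, hs2 (X * (U * V * Uᴴ) - (U * V * Uᴴ) * X) ∂ν ∂μ) ∂κ)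
      = (1 - (Module.finrank ℂ ↥(commSub A) : ℝ) / (d : ℝ) ^ 2) *
        (1 - (Module.finrank ℂ ↥(commSub B) : ℝ) / (d : ℝ) ^ 2) / (1 - 1 / (d : ℝ) ^ 2) := by
  have := hμ.1
  have := hν.1
  have := hκ.1
  have : Nontrivial (Fin d) := Fin.nontrivial_iff_two_le.2 hd
  have hd0 : (d : ℝ) ≠ 0 := by positivity
  let f : Matrix (Fin d) (Fin d) ℂ → Matrix (Fin d) (Fin d) ℂ × Matrix (Fin d) (Fin d) ℂ → ℝ :=
    fun U p => hs2 (p.1 * (U * p.2 * Uᴴ) - (U * p.2 * Uᴴ) * p.1)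
  have hfc : Continuous (Function.uncurry f) :=
    continuous_hs2.comp (by fun_prop)
  have hae : ∀ᵐ p ∂(μ.prod ν), p.1 ∈ unitary (Matrix (Fin d) (Fin d) ℂ) ∧
      p.2 ∈ unitary (Matrix (Fin d) (Fin d) ℂ) :=
    (Measure.quasiMeasurePreserving_fst.ae (hμ.ae_mem.mono fun _ h => h.2)).and
      (Measure.quasiMeasurePreserving_snd.ae (hν.ae_mem.mono fun _ h => h.2))
  have hbound : ∀ U p, U ∈ unitary (Matrix (Fin d) (Fin d) ℂ) →
      p.1 ∈ unitary (Matrix (Fin d) (Fin d) ℂ) → p.2 ∈ unitary (Matrix (Fin d) (Fin d) ℂ) →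
      ‖f U p‖ ≤ 4 * (d : ℝ) := by
    intro U p hU h1 h2
    rw [Real.norm_of_nonneg (hs2_nonneg _)]
    simpa using hs2_commutator_le h1 (conj_mem_unitary hU h2)
  have hint : Integrable (Function.uncurry f) (κ.prod (μ.prod ν)) := by
    refine Integrable.of_bound (C := 4 * (d : ℝ)) hfc.aestronglyMeasurable ?_
    filter_upwards [Measure.quasiMeasurePreserving_fst.ae (hκ.ae_mem.mono fun _ h => h.2),
      Measure.quasiMeasurePreserving_snd.ae hae] with q h1 h2
    exact hbound q.1 q.2 h1 h2.1 h2.2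
  have hinner : ∀ᵐ U ∂κ, (1 / (2 * (d : ℝ))) *
        ∫ X, ∫ V, hs2 (X * (U * V * Uᴴ) - (U * V * Uᴴ) * X) ∂ν ∂μ
      = (1 / (2 * (d : ℝ))) * ∫ p, f U p ∂(μ.prod ν) := by
    filter_upwards [hint.prod_right_ae] with U hU
    exact congrArg _ (integral_prod _ hU).symm
  rw [integral_congr_ae hinner, integral_const_mul, integral_integral_swap hint]
  have houter : (fun p => ∫ U, f U p ∂κ) =ᵐ[μ.prod ν] fun p => 2 * (d : ℝ) *
      ((1 - Complex.normSq (trace p.1) / (d : ℝ) ^ 2) *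
        ((1 - Complex.normSq (trace p.2) / (d : ℝ) ^ 2) / (1 - 1 / (d : ℝ) ^ 2))) := by
    filter_upwards [hae] with p hp
    simpa using integral_hs2_commutator_conj hκ hp.1 hp.2
  have hmean : ∀ (C : StarSubalgebra ℂ (Matrix (Fin d) (Fin d) ℂ))
      (ρ : Measure (Matrix (Fin d) (Fin d) ℂ)), IsHaar C ρ →
      ∫ X, (1 - Complex.normSq (trace X) / (d : ℝ) ^ 2) ∂ρ
        = 1 - (Module.finrank ℂ ↥(commSub C) : ℝ) / (d : ℝ) ^ 2 := by
    intro C ρ hρ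
    have := hρ.1
    have hi : Integrable (fun X : Matrix (Fin d) (Fin d) ℂ => Complex.normSq (trace X)) ρ := by
      refine Integrable.of_bound (C := (d : ℝ) ^ 2)
        (Complex.continuous_normSq.comp (by fun_prop)).aestronglyMeasurable ?_
      filter_upwards [hρ.ae_mem] with X hX
      have h1 : ‖trace X‖ ≤ d := by simpa using norm_trace_le_card hX.2
      rw [Real.norm_of_nonneg (Complex.normSq_nonneg _), Complex.normSq_eq_norm_sq]
      gcongr
    rw [integral_sub (integrable_const _) (hi.div_const _), integral_div,
      hρ.integral_normSq_trace]
    simp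
  rw [integral_congr_ae houter, integral_const_mul,
    integral_prod_mul (fun X : Matrix (Fin d) (Fin d) ℂ =>
      1 - Complex.normSq (trace X) / (d : ℝ) ^ 2)
      (fun V : Matrix (Fin d) (Fin d) ℂ =>
      (1 - Complex.normSq (trace V) / (d : ℝ) ^ 2) / (1 - 1 / (d : ℝ) ^ 2)),
    integral_div, hmean A μ hμ, hmean B ν hν]
  field_simp
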